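/- arXiv:math/0210128 — 5 statements merged into one kernel-verified Lean document; each statement's English description precedes it below -/
import Mathlib

section
/- For every γ ∈ (0,1) there exists a constant C_γ > 0 (depending only on n and γ) such that the following holds: for every r > 0, every (X,T) ∈ ℝⁿ × ℝ, and every smooth function h defined on an open neighbourhood of the parabolic cylinder P_r(X,T) which satisfies ∂h/∂t ≤ Δh − h² at every point of P_r(X,T) at which h ≥ 0, one has h ≤ C_γ / r² at every point of P_{γr}(X,T). -/
open MeasureTheory
open scoped BigOperators

namespace YangMillsFlow

noncomputable section

/-- Spacetime `ℝⁿ × ℝ`. -/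
abbrev ST (n : ℕ) := (Fin n → ℝ) × ℝ

/-- `m × m` real matrices, modelled as functions. -/
abbrev Mat (m : ℕ) := Fin m → Fin m → ℝ

/-- Matrix multiplication. -/
def mmul {m : ℕ} (a b : Mat m) : Mat m := fun α β => ∑ γ, a α γ * b γ β

/-- The unit vector in the spatial direction `p`. -/
def spaceVec (n : ℕ) (p : Fin n) : ST n := (Pi.single p 1, 0)

/-- The unit vector in the time direction. -/
def timeVec (n : ℕ) : ST n := (0, 1)

variable {n m : ℕ} {E : Type*} [NormedAddCommGroup E] [NormedSpace ℝ E]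

/-- Spatial partial derivative `∂ₚ`. -/
def pd (p : Fin n) (f : ST n → E) (z : ST n) : E := fderiv ℝ f z (spaceVec n p)

/-- Time derivative `∂ₜ`. -/
def td (f : ST n → E) (z : ST n) : E := fderiv ℝ f z (timeVec n)

/-- Iterated spatial partial derivatives. -/
def iterPD : {k : ℕ} → (Fin k → Fin n) → (ST n → E) → ST n → E
  | 0, _, f => f
  | _ + 1, ps, f => iterPD (fun i => ps i.succ) (pd (ps 0) f)

/-- The spatial Laplacian `Δ = ∑ₚ ∂ₚ²`. -/
def lap (f : ST n → ℝ) (z : ST n) : ℝ := ∑ p, pd p (fun w => pd p f w) z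

/-- A time-dependent connection on the trivial bundle `ℝⁿ × ℝᵐ`. -/
abbrev Conn (n m : ℕ) := Fin n → ST n → Mat m

/-- The curvature `F_{ij} = ∂ᵢAⱼ - ∂ⱼAᵢ + AᵢAⱼ - AⱼAᵢ`. -/
def curv (A : Conn n m) (i j : Fin n) (z : ST n) : Mat m :=
  pd i (A j) z - pd j (A i) z + mmul (A i z) (A j z) - mmul (A j z) (A i z)

/-- The covariant derivative of a `k`-tensor of matrices:
`(DT)_{p i₁ … i_k} = ∂ₚ T_{i₁ … i_k} + Aₚ T_{i₁ … i_k} - T_{i₁ … i_k} Aₚ`. -/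
def covD (A : Conn n m) {k : ℕ} (T : (Fin k → Fin n) → ST n → Mat m) :
    (Fin (k + 1) → Fin n) → ST n → Mat m :=
  fun idx z =>
    pd (idx 0) (T (fun i => idx i.succ)) z
      + mmul (A (idx 0) z) (T (fun i => idx i.succ) z)
      - mmul (T (fun i => idx i.succ) z) (A (idx 0) z)

/-- The curvature as a `2`-tensor. -/
def curvT (A : Conn n m) : (Fin 2 → Fin n) → ST n → Mat m :=
  fun idx z => curv A (idx 0) (idx 1) z

/-- The `k`-fold iterated covariant derivative `DᵏF` of the curvature (`D⁰F = F`). -/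
def DkF (A : Conn n m) : (k : ℕ) → (Fin (k + 2) → Fin n) → ST n → Mat m
  | 0 => curvT A
  | k + 1 => covD A (DkF A k)

/-- The squared Frobenius norm of a matrix. -/
def matNormSq {m : ℕ} (M : Mat m) : ℝ := ∑ α, ∑ β, (M α β) ^ 2

/-- The squared pointwise norm of a `k`-tensor of matrices. -/
def tnormSq {k : ℕ} (T : (Fin k → Fin n) → ST n → Mat m) (z : ST n) : ℝ :=
  ∑ idx : Fin k → Fin n, matNormSq (T idx z)

/-- `A` solves the Yang-Mills flow `∂ₜ Aⱼ = ∑ₚ (∂ₚ F_{pj} + Aₚ F_{pj} - F_{pj} Aₚ)` on `U`. -/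
def IsYMFlow (A : Conn n m) (U : Set (ST n)) : Prop :=
  ∀ z ∈ U, ∀ j : Fin n,
    td (A j) z =
      ∑ p, (pd p (fun w => curv A p j w) z + mmul (A p z) (curv A p j z)
        - mmul (curv A p j z) (A p z))

/-- The connection `A` is smooth on the set `U`. -/
def SmoothConnOn (A : Conn n m) (U : Set (ST n)) : Prop :=
  ∀ i, ContDiffOn ℝ (⊤ : ℕ∞) (A i) U

/-- The parabolic cylinder `P_r(X,T)`. -/
def pCyl (n : ℕ) (r : ℝ) (X : Fin n → ℝ) (T : ℝ) : Set (ST n) :=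
  {z | Real.sqrt (∑ i, (z.1 i - X i) ^ 2) ≤ r ∧ T - r ^ 2 ≤ z.2 ∧ z.2 ≤ T}

/-- The backward heat kernel on `ℝⁿ` centred at `(X, T)`. -/
def backHeat (n : ℕ) (X : Fin n → ℝ) (T : ℝ) (z : ST n) : ℝ :=
  (4 * Real.pi * (T - z.2)) ^ (-(n : ℝ) / 2) *
    Real.exp (-(∑ i, (z.1 i - X i) ^ 2) / (4 * (T - z.2)))

/-- `A` and all its spatial partial derivatives grow at most polynomially in `x`,
locally uniformly in `t` (for times in `J`). -/
def ModerateGrowth (A : Conn n m) (J : Set ℝ) : Prop :=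
  ∀ i, ∀ (k : ℕ) (ps : Fin k → Fin n), ∀ t₀ t₁ : ℝ, ∃ C q : ℝ, ∀ z : ST n,
    z.2 ∈ J → t₀ ≤ z.2 → t₁ ≥ z.2 → ∀ α β,
      |iterPD ps (A i) z α β| ≤ C * (1 + ∑ j, (z.1 j) ^ 2) ^ q

/-- At a local maximum the second derivative is nonpositive. -/
lemma deriv_deriv_nonpos_of_isLocalMax {f : ℝ → ℝ} {x : ℝ} (hf : ContinuousAt f x)
    (hmax : IsLocalMax f x) : deriv (deriv f) x ≤ 0 := by
  by_contra! hpos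
  have hmin := isLocalMin_of_deriv_deriv_pos hpos hmax.deriv_eq_zero hf
  have hconst : f =ᶠ[nhds x] fun _ => f x := by
    filter_upwards [hmin, hmax] with y h1 h2 using le_antisymm h2 h1
  have h0 : deriv (deriv f) x = 0 := by
    rw [hconst.deriv.deriv_eq]
    simp
  exact hpos.not_ge h0.le

/-- At a one-sided maximum, approached from the left, the derivative is nonnegative. -/
lemma deriv_nonneg_of_eventually_le_left {f : ℝ → ℝ} {f' x : ℝ} (hf : HasDerivAt f f' x)
    (hmax : ∀ᶠ y in nhdsWithin x (Set.Iio x), f y ≤ f x) : 0 ≤ f' := by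
  have ht := (hasDerivWithinAt_iff_tendsto_slope' (s := Set.Iio x) (by simp)).1
    hf.hasDerivWithinAt
  refine ge_of_tendsto ht ?_
  filter_upwards [hmax, self_mem_nhdsWithin] with y h1 h2
  rw [slope_def_field]
  exact div_nonneg_of_nonpos (sub_nonpos.2 h1) (sub_nonpos.2 (le_of_lt h2))

/-- If `g * q` has a local maximum at `0`, the second derivative of `g` is controlled by `q`. -/
lemma second_deriv_mul_sq_le_of_isLocalMax_mul {g g₁ q q₁ : ℝ → ℝ} {g₂ q₂ : ℝ}
    (hg : ∀ᶠ s in nhds 0, HasDerivAt g (g₁ s) s) (hg₁ : HasDerivAt g₁ g₂ 0)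
    (hq : ∀ s, HasDerivAt q (q₁ s) s) (hq₁ : HasDerivAt q₁ q₂ 0) (hq0 : 0 < q 0)
    (hmax : IsLocalMax (fun s => g s * q s) 0) :
    g₂ * q 0 ^ 2 ≤ g 0 * (2 * q₁ 0 ^ 2 - q 0 * q₂) := by
  have hd : ∀ᶠ s in nhds 0, HasDerivAt (fun s => g s * q s) (g₁ s * q s + g s * q₁ s) s := by
    filter_upwards [hg] with s hs using hs.mul (hq s)
  have h1 : g₁ 0 * q 0 + g 0 * q₁ 0 = 0 := hmax.hasDerivAt_eq_zero hd.self_of_nhds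
  have hdd : deriv (fun s => g s * q s) =ᶠ[nhds 0] fun s => g₁ s * q s + g s * q₁ s := by
    filter_upwards [hd] with s hs using hs.deriv
  have h2 := deriv_deriv_nonpos_of_isLocalMax hd.self_of_nhds.continuousAt hmax
  have hd₂ : HasDerivAt (fun s => g₁ s * q s + g s * q₁ s)
      (g₂ * q 0 + g₁ 0 * q₁ 0 + (g₁ 0 * q₁ 0 + g 0 * q₂)) 0 :=
    (hg₁.mul (hq 0)).add (hg.self_of_nhds.mul hq₁)
  rw [hdd.deriv_eq, hd₂.deriv] at h2
  have h3 := mul_nonpos_of_nonneg_of_nonpos hq0.le h2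
  linear_combination h3 - 2 * q₁ 0 * h1

/-- Restriction of a differentiable function to a line. -/
lemma hasDerivAt_comp_line {f : ST n → ℝ} {z v : ST n} {s : ℝ}
    (hf : DifferentiableAt ℝ f (z + s • v)) :
    HasDerivAt (fun s : ℝ => f (z + s • v)) (fderiv ℝ f (z + s • v) v) s := by
  have hl : HasDerivAt (fun s : ℝ => z + s • v) v s := by
    simpa using ((hasDerivAt_id s).smul_const v).const_add z
  exact hf.hasFDerivAt.comp_hasDerivAt s hl

/-- The parabolic cylinder in terms of squared distances. -/
lemma mem_pCyl {r : ℝ} (hr : 0 ≤ r) {X : Fin n → ℝ} {T : ℝ} {z : ST n} :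
    z ∈ pCyl n r X T ↔ ∑ i, (z.1 i - X i) ^ 2 ≤ r ^ 2 ∧ T - r ^ 2 ≤ z.2 ∧ z.2 ≤ T := by
  rw [pCyl, Set.mem_ofPred_eq, Real.sqrt_le_left hr]

/-- Parabolic cylinders are compact. -/
lemma isCompact_pCyl {r : ℝ} (hr : 0 ≤ r) (X : Fin n → ℝ) (T : ℝ) :
    IsCompact (pCyl n r X T) := by
  refine ((isCompact_closedBall X r).prod
    (isCompact_Icc (a := T - r ^ 2) (b := T))).of_isClosed_subset ?_ ?_
  · have : pCyl n r X T = {z : ST n | Real.sqrt (∑ i, (z.1 i - X i) ^ 2) ≤ r} ∩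
        ({z | T - r ^ 2 ≤ z.2} ∩ {z | z.2 ≤ T}) := rfl
    rw [this]
    refine (isClosed_le (by fun_prop) (by fun_prop)).inter
      ((isClosed_le (by fun_prop) (by fun_prop)).inter (isClosed_le (by fun_prop) (by fun_prop)))
  · intro z hz
    rw [mem_pCyl hr] at hz
    refine ⟨?_, hz.2⟩
    rw [Metric.mem_closedBall, dist_pi_le_iff hr]
    intro i
    rw [Real.dist_eq]
    refine abs_le_of_sq_le_sq ?_ hr
    exact (Finset.single_le_sum (f := fun i => (z.1 i - X i) ^ 2)
      (fun i _ => sq_nonneg _) (Finset.mem_univ i)).trans hz.1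

/-- The cutoff `(r² - |x - X|²)² (t - T + r²)`, vanishing on the parabolic boundary. -/
def parabolicCutoff (r : ℝ) (X : Fin n → ℝ) (T : ℝ) (z : ST n) : ℝ :=
  (r ^ 2 - ∑ i, (z.1 i - X i) ^ 2) ^ 2 * (z.2 - T + r ^ 2)

/-- Squared distance along a coordinate line. -/
lemma sum_sq_add_smul_spaceVec (X : Fin n → ℝ) (z : ST n) (p : Fin n) (s : ℝ) :
    ∑ i, ((z + s • spaceVec n p).1 i - X i) ^ 2 =
      ∑ i, (z.1 i - X i) ^ 2 + 2 * s * (z.1 p - X p) + s ^ 2 := by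
  have h : ∀ i, ((z + s • spaceVec n p).1 i - X i) ^ 2 =
      (z.1 i - X i) ^ 2 + if i = p then 2 * s * (z.1 i - X i) + s ^ 2 else 0 := by
    intro i
    simp only [spaceVec, Prod.fst_add, Prod.smul_fst, Pi.add_apply, Pi.smul_apply,
      Pi.single_apply, smul_eq_mul]
    split_ifs <;> ring
  simp only [h, Finset.sum_add_distrib, Finset.sum_ite_eq', Finset.mem_univ, if_true]
  ring

/-- Second order condition in a coordinate direction at a maximum of `h` times the cutoff. -/
lemma pd_pd_mul_cutoff_le {r : ℝ} (hr : 0 < r) {X : Fin n → ℝ} {T : ℝ} {h : ST n → ℝ} {z : ST n}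
    (hh : ContDiffAt ℝ 2 h z) (hz : z ∈ pCyl n r X T)
    (ha : 0 < r ^ 2 - ∑ i, (z.1 i - X i) ^ 2) (hb : 0 < z.2 - T + r ^ 2)
    (hmax : IsMaxOn (fun w => h w * parabolicCutoff r X T w) (pCyl n r X T) z) (p : Fin n) :
    pd p (fun w => pd p h w) z * parabolicCutoff r X T z ≤
      h z * (z.2 - T + r ^ 2) *
        (24 * (z.1 p - X p) ^ 2 + 4 * (r ^ 2 - ∑ i, (z.1 i - X i) ^ 2)) := by
  set a := r ^ 2 - ∑ i, (z.1 i - X i) ^ 2 with ha_def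
  set b := z.2 - T + r ^ 2
  set y := z.1 p - X p
  set v := spaceVec n p
  have hv : v.2 = 0 := rfl
  have hline : Filter.Tendsto (fun s : ℝ => z + s • v) (nhds 0) (nhds z) := by
    have : Continuous fun s : ℝ => z + s • v := by fun_prop
    simpa using this.tendsto 0
  have hg : ∀ᶠ s : ℝ in nhds 0, HasDerivAt (fun s : ℝ => h (z + s • v)) (pd p h (z + s • v)) s := by
    filter_upwards [hline.eventually (hh.eventually (by simp))] with s hs
    exact hasDerivAt_comp_line (hs.differentiableAt (by simp))
  have hpd : DifferentiableAt ℝ (fun w => pd p h w) z := by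
    have : ContDiffAt ℝ 1 (fun w => pd p h w) z :=
      (hh.fderiv_right (m := 1) (by norm_num)).clm_apply contDiffAt_const
    exact this.differentiableAt (by simp)
  have hg₁ : HasDerivAt (fun s : ℝ => pd p h (z + s • v)) (pd p (fun w => pd p h w) z) 0 := by
    have := hasDerivAt_comp_line (f := fun w => pd p h w) (z := z) (v := v) (s := 0)
      (by simpa using hpd)
    simpa [pd] using this
  have hcut : ∀ s : ℝ, parabolicCutoff r X T (z + s • v) = (a - 2 * s * y - s ^ 2) ^ 2 * b := by
    intro s
    rw [parabolicCutoff, sum_sq_add_smul_spaceVec]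
    simp only [Prod.snd_add, Prod.smul_snd, hv, smul_zero, add_zero, ha_def]
    ring
  have hin : ∀ s : ℝ, HasDerivAt (fun s : ℝ => a - 2 * s * y - s ^ 2) (-2 * y - 2 * s) s := by
    intro s
    have h1 := ((((hasDerivAt_id s).const_mul 2).mul_const y).const_sub a).sub
      ((hasDerivAt_id s).pow 2)
    exact h1.congr_deriv (by simp)
  have hq : ∀ s : ℝ, HasDerivAt (fun s : ℝ => (a - 2 * s * y - s ^ 2) ^ 2 * b)
      (2 * (a - 2 * s * y - s ^ 2) * (-2 * y - 2 * s) * b) s := by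
    intro s
    exact (((hin s).pow 2).mul_const b).congr_deriv (by simp)
  have hq₁ : HasDerivAt (fun s : ℝ => 2 * (a - 2 * s * y - s ^ 2) * (-2 * y - 2 * s) * b)
      ((8 * y ^ 2 - 4 * a) * b) 0 := by
    have h1 := ((((hin 0).const_mul 2).mul
      (((hasDerivAt_id (0 : ℝ)).const_mul 2).const_sub (-2 * y))).mul_const b)
    exact h1.congr_deriv (by simp only [id]; ring)
  have hloc : IsLocalMax (fun s : ℝ => h (z + s • v) * ((a - 2 * s * y - s ^ 2) ^ 2 * b)) 0 := by
    have hpos : ∀ᶠ s : ℝ in nhds 0, 0 < a - 2 * s * y - s ^ 2 :=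
      (hin 0).continuousAt.eventually (lt_mem_nhds (by simpa using ha))
    filter_upwards [hpos] with s hs
    have hmem : z + s • v ∈ pCyl n r X T := by
      rw [mem_pCyl hr.le] at hz ⊢
      refine ⟨?_, ?_⟩
      · rw [sum_sq_add_smul_spaceVec]
        linarith
      · simpa [hv] using hz.2
    have := hmax hmem
    simp only [Set.mem_ofPred_eq, hcut] at this
    have h0 := hcut 0
    simp only [zero_smul, add_zero] at h0
    rw [h0] at this
    simpa using this
  have hq0 : 0 < (a - 2 * (0 : ℝ) * y - 0 ^ 2) ^ 2 * b := by
    simp only [mul_zero, zero_mul, sub_zero, ne_eq, OfNat.ofNat_ne_zero, not_false_eq_true, zero_pow]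
    positivity
  have key := second_deriv_mul_sq_le_of_isLocalMax_mul hg hg₁ hq hq₁ hq0 hloc
  have hψ : parabolicCutoff r X T z = a ^ 2 * b := rfl
  rw [hψ]
  have hab : 0 < a ^ 2 * b := by positivity
  refine le_of_mul_le_mul_right ?_ hab
  simp only [mul_zero, zero_mul, sub_zero, ne_eq, OfNat.ofNat_ne_zero, not_false_eq_true, zero_pow,
    zero_smul, add_zero] at key
  linear_combination key

/-- First order condition in time at a maximum of `h` times the cutoff. -/
lemma td_mul_cutoff_ge {r : ℝ} (hr : 0 < r) {X : Fin n → ℝ} {T : ℝ} {h : ST n → ℝ} {z : ST n}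
    (hh : DifferentiableAt ℝ h z) (hz : z ∈ pCyl n r X T) (hb : 0 < z.2 - T + r ^ 2)
    (hmax : IsMaxOn (fun w => h w * parabolicCutoff r X T w) (pCyl n r X T) z) :
    0 ≤ td h z * parabolicCutoff r X T z + h z * (r ^ 2 - ∑ i, (z.1 i - X i) ^ 2) ^ 2 := by
  set a := r ^ 2 - ∑ i, (z.1 i - X i) ^ 2 with ha_def
  set v := timeVec n
  have hcut : ∀ s : ℝ, parabolicCutoff r X T (z + s • v) = a ^ 2 * (z.2 - T + r ^ 2 + s) := by
    intro s
    simp only [parabolicCutoff, v, timeVec, Prod.fst_add, Prod.snd_add, Prod.smul_fst,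
      Prod.smul_snd, smul_zero, add_zero, smul_eq_mul, ha_def]
    ring
  have hg : HasDerivAt (fun s : ℝ => h (z + s • v)) (td h z) 0 := by
    have := hasDerivAt_comp_line (f := h) (z := z) (v := v) (s := 0) (by simpa using hh)
    simpa [td] using this
  have hq : HasDerivAt (fun s : ℝ => a ^ 2 * (z.2 - T + r ^ 2 + s)) (a ^ 2) 0 := by
    simpa using ((hasDerivAt_id (0 : ℝ)).const_add (z.2 - T + r ^ 2)).const_mul (a ^ 2)
  have hd := hg.mul hq
  have hnonneg := deriv_nonneg_of_eventually_le_left hd ?_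
  · have hψ : parabolicCutoff r X T z = a ^ 2 * (z.2 - T + r ^ 2) := rfl
    rw [hψ]
    simpa using hnonneg
  · have hpos : ∀ᶠ s : ℝ in nhdsWithin 0 (Set.Iio 0), -(z.2 - T + r ^ 2) < s :=
      mem_nhdsWithin_of_mem_nhds (lt_mem_nhds (by linarith))
    filter_upwards [hpos, self_mem_nhdsWithin] with s hs hs0
    have hmem : z + s • v ∈ pCyl n r X T := by
      rw [mem_pCyl hr.le] at hz ⊢
      simp only [v, timeVec, Prod.fst_add, Prod.snd_add, Prod.smul_fst,
        Prod.smul_snd, smul_zero, add_zero, smul_eq_mul, mul_one]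
      refine ⟨hz.1, by linarith, ?_⟩
      have : s < 0 := hs0
      linarith [hz.2.2]
    have := hmax hmem
    simp only [Set.mem_ofPred_eq, hcut] at this
    have h0 := hcut 0
    simp only [zero_smul, add_zero] at h0
    rw [h0] at this
    simpa using this

/-- Bound for `h` times the cutoff at a positive interior maximum. -/
lemma mul_cutoff_le_of_isMaxOn {r : ℝ} (hr : 0 < r) {X : Fin n → ℝ} {T : ℝ} {h : ST n → ℝ}
    {z : ST n} (hh : ContDiffAt ℝ 2 h z) (hz : z ∈ pCyl n r X T)
    (hineq : td h z ≤ lap h z - h z ^ 2) (hpos : 0 < h z)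
    (ha : 0 < r ^ 2 - ∑ i, (z.1 i - X i) ^ 2) (hb : 0 < z.2 - T + r ^ 2)
    (hmax : IsMaxOn (fun w => h w * parabolicCutoff r X T w) (pCyl n r X T) z) :
    h z * parabolicCutoff r X T z ≤ (25 + 4 * n) * r ^ 4 := by
  have hspace := Finset.sum_le_sum fun p (_ : p ∈ Finset.univ) =>
    pd_pd_mul_cutoff_le hr hh hz ha hb hmax p
  have htime := td_mul_cutoff_ge hr (hh.differentiableAt (by simp)) hz hb hmax
  rw [← Finset.sum_mul, ← Finset.mul_sum, Finset.sum_add_distrib, ← Finset.mul_sum,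
    Finset.sum_const, Finset.card_univ, Fintype.card_fin, nsmul_eq_mul] at hspace
  change lap h z * _ ≤ _ at hspace
  rw [mem_pCyl hr.le] at hz
  have hψ : 0 < parabolicCutoff r X T z := by
    unfold parabolicCutoff
    positivity
  have hS : 0 ≤ ∑ i, (z.1 i - X i) ^ 2 := Finset.sum_nonneg fun i _ => sq_nonneg _
  set S := ∑ i, (z.1 i - X i) ^ 2
  set b := z.2 - T + r ^ 2
  have hbr : b ≤ r ^ 2 := by simp only [b]; linarith [hz.2.2]
  have hn : (0 : ℝ) ≤ n := n.cast_nonneg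
  have h1 : b * (24 * S + n * (4 * (r ^ 2 - S))) ≤ r ^ 2 * ((24 + 4 * n) * r ^ 2) := by
    refine mul_le_mul hbr ?_ (by positivity) (by positivity)
    nlinarith [mul_nonneg hn hS, hz.1]
  have h2 : (r ^ 2 - S) ^ 2 ≤ (r ^ 2) ^ 2 := pow_le_pow_left₀ ha.le (by linarith) 2
  refine le_of_mul_le_mul_left ?_ hpos
  have h3 := mul_le_mul_of_nonneg_right hineq hψ.le
  have h4 := mul_le_mul_of_nonneg_left (add_le_add h1 h2) hpos.le
  linear_combination h3 + hspace + htime + h4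

/-- the parabolic estimate for supersolutions of `∂ₜ h ≤ Δh - h²`. -/
theorem parabolic_sup_estimate (n : ℕ) (γ : ℝ) (hγ0 : 0 < γ) (hγ1 : γ < 1) :
    ∃ C : ℝ, 0 < C ∧
      ∀ (r : ℝ), 0 < r → ∀ (X : Fin n → ℝ) (T : ℝ) (U : Set (ST n)) (h : ST n → ℝ),
        IsOpen U → pCyl n r X T ⊆ U → ContDiffOn ℝ (⊤ : ℕ∞) h U →
        (∀ z ∈ pCyl n r X T, 0 ≤ h z → td h z ≤ lap h z - (h z) ^ 2) →
        ∀ z ∈ pCyl n (γ * r) X T, h z ≤ C / r ^ 2 := by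
  have hγ : 0 < 1 - γ ^ 2 := by nlinarith
  refine ⟨(25 + 4 * n) / (1 - γ ^ 2) ^ 3, by positivity, ?_⟩
  intro r hr X T U h hU hsub hsmooth hineq z hz
  rcases le_or_gt (h z) 0 with hle | hpos
  · exact hle.trans (by positivity)
  rw [mem_pCyl (by positivity)] at hz
  have hr2 : (γ * r) ^ 2 ≤ r ^ 2 := by nlinarith [mul_pos hγ (pow_pos hr 2)]
  have hzr : z ∈ pCyl n r X T := by
    rw [mem_pCyl hr.le]
    exact ⟨hz.1.trans hr2, by linarith [hz.2.1], hz.2.2⟩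
  have hψz : (1 - γ ^ 2) ^ 3 * r ^ 6 ≤ parabolicCutoff r X T z := by
    have hc : 0 ≤ (1 - γ ^ 2) * r ^ 2 := by positivity
    have h1 : (1 - γ ^ 2) * r ^ 2 ≤ r ^ 2 - ∑ i, (z.1 i - X i) ^ 2 := by linarith [hz.1]
    have h2 : (1 - γ ^ 2) * r ^ 2 ≤ z.2 - T + r ^ 2 := by linarith [hz.2.1]
    calc (1 - γ ^ 2) ^ 3 * r ^ 6 = ((1 - γ ^ 2) * r ^ 2) ^ 2 * ((1 - γ ^ 2) * r ^ 2) := by ring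
      _ ≤ _ := mul_le_mul (pow_le_pow_left₀ hc h1 2) h2 hc (sq_nonneg _)
  have hcont : ContinuousOn (fun w => h w * parabolicCutoff r X T w) (pCyl n r X T) := by
    refine (hsmooth.continuousOn.mono hsub).mul (Continuous.continuousOn ?_)
    unfold parabolicCutoff
    fun_prop
  obtain ⟨w, hw, hmax⟩ := (isCompact_pCyl hr.le X T).exists_isMaxOn ⟨z, hzr⟩ hcont
  have hzw : h z * parabolicCutoff r X T z ≤ h w * parabolicCutoff r X T w := hmax hzr
  have hψz0 : 0 < parabolicCutoff r X T z := lt_of_lt_of_le (by positivity) hψz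
  have hFw : 0 < h w * parabolicCutoff r X T w := (mul_pos hpos hψz0).trans_le hzw
  have hwm := (mem_pCyl hr.le).1 hw
  have ha0 : 0 ≤ r ^ 2 - ∑ i, (w.1 i - X i) ^ 2 := by linarith [hwm.1]
  have hb0 : 0 ≤ w.2 - T + r ^ 2 := by linarith [hwm.2.1]
  have hψw0 : 0 ≤ parabolicCutoff r X T w := mul_nonneg (sq_nonneg _) hb0
  have hhw : 0 < h w := pos_of_mul_pos_left hFw hψw0
  have hψw : parabolicCutoff r X T w ≠ 0 := right_ne_zero_of_mul hFw.ne'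
  have ha : 0 < r ^ 2 - ∑ i, (w.1 i - X i) ^ 2 :=
    ha0.lt_of_ne' fun h0 => hψw (by simp [parabolicCutoff, h0])
  have hb : 0 < w.2 - T + r ^ 2 :=
    hb0.lt_of_ne' fun h0 => hψw (by simp [parabolicCutoff, h0])
  have hcd : ContDiffAt ℝ 2 h w :=
    (hsmooth.contDiffAt (hU.mem_nhds (hsub hw))).of_le (WithTop.coe_le_coe.2 (le_top : (2 : ℕ∞) ≤ ⊤))
  have hbound := mul_cutoff_le_of_isMaxOn hr hcd hw (hineq w hw hhw.le) hhw ha hb hmax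
  have hfinal : h z * ((1 - γ ^ 2) ^ 3 * r ^ 6) ≤ (25 + 4 * n) * r ^ 4 :=
    (mul_le_mul_of_nonneg_left hψz hpos.le).trans (hzw.trans hbound)
  rw [div_div, le_div_iff₀ (by positivity)]
  refine le_of_mul_le_mul_right ?_ (pow_pos hr 4)
  linear_combination hfinal

end

end YangMillsFlow
end

section
/- Let V be a finite-dimensional real normed vector space and let a : ℝⁿ × (−∞,0) → V be a smooth map satisfying, at every point (x,t) with t < 0, the equation ∂a/∂t (x,t) + (1/(2t)) Σ_p x^p ∂a/∂x^p (x,t) + (1/(2t)) a(x,t) = 0. Then a satisfies the dilation condition a(x,t) = λ a(λx, λ²t) for every λ > 0 and every (x,t) ∈ ℝⁿ × (−∞,0). -/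
open MeasureTheory
open scoped BigOperators

namespace YangMillsFlow

noncomputable section

variable {n m : ℕ} {E : Type*} [NormedAddCommGroup E] [NormedSpace ℝ E]

/-- A spacetime vector in terms of the coordinate directions. -/
lemma eq_sum_spaceVec_add_timeVec (v : ST n) :
    v = (∑ p, v.1 p • spaceVec n p) + v.2 • timeVec n := by
  ext i
  · simp [spaceVec, timeVec, Prod.fst_sum, Finset.sum_apply, Pi.single_apply]
  · simp [spaceVec, timeVec, Prod.snd_sum]

/-- The derivative of a function along a vector in terms of its partial derivatives. -/
lemma fderiv_eq_sum_pd_add_td (f : ST n → E) (z v : ST n) :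
    fderiv ℝ f z v = (∑ p, v.1 p • pd p f z) + v.2 • td f z := by
  conv_lhs => rw [eq_sum_spaceVec_add_timeVec v]
  simp only [map_add, map_sum, map_smul, pd, td]

/-- The parabolic form of Euler's identity: the soliton equation says that the derivative along
the generator `(x, 2t)` of parabolic dilations is `-f`. -/
lemma fderiv_parabolic_generator (f : ST n → E) (z : ST n) (hz : z.2 ≠ 0)
    (h : td f z + (1 / (2 * z.2)) • (∑ p, z.1 p • pd p f z) + (1 / (2 * z.2)) • f z = 0) :
    fderiv ℝ f z (z.1, 2 * z.2) = -f z := by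
  have h' := congrArg (fun v => (2 * z.2) • v) h
  have h2 : 2 * z.2 * (1 / (2 * z.2)) = 1 := by field_simp
  simp only [smul_add, smul_smul, h2, one_smul, smul_zero] at h'
  rw [fderiv_eq_sum_pd_add_td, eq_neg_iff_add_eq_zero, ← h']
  abel

/-- The derivative of the parabolic rescaling `s ↦ s f(sx, s²t)`. -/
lemma hasDerivAt_parabolic_rescaling (f : ST n → E) (z : ST n) (s : ℝ)
    (hf : DifferentiableAt ℝ f (s • z.1, s ^ 2 * z.2)) :
    HasDerivAt (fun r : ℝ => r • f (r • z.1, r ^ 2 * z.2))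
      (fderiv ℝ f (s • z.1, s ^ 2 * z.2) (s • z.1, 2 * (s ^ 2 * z.2))
        + f (s • z.1, s ^ 2 * z.2)) s := by
  have hc : HasDerivAt (fun r : ℝ => ((r • z.1, r ^ 2 * z.2) : ST n)) (z.1, 2 * s * z.2) s := by
    refine HasDerivAt.prodMk ?_ ?_
    · simpa using (hasDerivAt_id s).smul_const z.1
    · simpa using (hasDerivAt_pow 2 s).mul_const z.2
  have hd := (hasDerivAt_id s).smul (hf.hasFDerivAt.comp_hasDerivAt s hc)
  have hv : ((s • z.1, 2 * (s ^ 2 * z.2)) : ST n) = s • (z.1, 2 * s * z.2) := by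
    ext i
    · simp
    · simp only [Prod.smul_mk, smul_eq_mul]
      ring
  rw [hv, map_smul]
  simpa only [one_smul] using! hd

/-- Lemma 3.2, a solution of the soliton ODE is homothetically shrinking. -/
theorem shrinking_soliton_dilation (n : ℕ) (V : Type*) [NormedAddCommGroup V]
    [NormedSpace ℝ V] [FiniteDimensional ℝ V] (a : ST n → V)
    (hsmooth : ContDiffOn ℝ (⊤ : ℕ∞) a {z : ST n | z.2 < 0})
    (heq : ∀ z : ST n, z.2 < 0 →
      td a z + (1 / (2 * z.2)) • (∑ p, z.1 p • pd p a z)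
        + (1 / (2 * z.2)) • a z = 0) :
    ∀ lam : ℝ, 0 < lam → ∀ z : ST n, z.2 < 0 →
      a z = lam • a (lam • z.1, lam ^ 2 * z.2) := by
  intro lam hlam z hz
  have hopen : IsOpen {w : ST n | w.2 < 0} := isOpen_lt continuous_snd continuous_const
  have hderiv : ∀ s ∈ Set.Ioi (0 : ℝ),
      HasDerivAt (fun r : ℝ => r • a (r • z.1, r ^ 2 * z.2)) 0 s := by
    intro s hs
    have hneg : s ^ 2 * z.2 < 0 := mul_neg_of_pos_of_neg (pow_pos hs 2) hz
    have hd : DifferentiableAt ℝ a (s • z.1, s ^ 2 * z.2) :=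
      (hsmooth.contDiffAt (hopen.mem_nhds hneg)).differentiableAt (by simp)
    have h := hasDerivAt_parabolic_rescaling a z s hd
    rwa [fderiv_parabolic_generator a (s • z.1, s ^ 2 * z.2) hneg.ne (heq _ hneg),
      neg_add_cancel] at h
  have hconst := isOpen_Ioi.is_const_of_deriv_eq_zero isPreconnected_Ioi
    (fun s hs => (hderiv s hs).differentiableAt.differentiableWithinAt)
    (fun s hs => (hderiv s hs).deriv) (Set.mem_Ioi.2 one_pos) (Set.mem_Ioi.2 hlam)
  simpa using hconst

end

end YangMillsFlow
end

section
/- Let Ā = (Ā_1, …, Ā_n) be a family of smooth m×m real matrix-valued functions on ℝⁿ × (−∞,0) satisfying, for every i and every (x,t), the equation ∂_t Ā_i + (1/(2t)) Σ_p x^p ( ∂_p Ā_i − ∂_i Ā_p + Ā_p Ā_i − Ā_i Ā_p ) = 0. If Σ_p x^p Ā_p(x,−1) = 0 for all x ∈ ℝⁿ, then Σ_p x^p Ā_p(x,t) = 0 for all (x,t) ∈ ℝⁿ × (−∞,0). -/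
open MeasureTheory
open scoped BigOperators

namespace YangMillsFlow

noncomputable section

variable {n m : ℕ} {E : Type*} [NormedAddCommGroup E] [NormedSpace ℝ E]

/-- A contraction of an antisymmetric family with a symmetric product of coefficients vanishes. -/
theorem sum_smul_sum_smul_eq_zero_of_antisymm (x : Fin n → ℝ) (F : Fin n → Fin n → E)
    (hF : ∀ i p, F i p = -F p i) : ∑ i, x i • ∑ p, x p • F i p = 0 := by
  have h : ∑ i, x i • ∑ p, x p • F i p = -∑ i, x i • ∑ p, x p • F i p := by
    simp only [Finset.smul_sum]
    conv_lhs => rw [Finset.sum_comm]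
    simp only [← Finset.sum_neg_distrib]
    refine Finset.sum_congr rfl fun i _ => Finset.sum_congr rfl fun p _ => ?_
    rw [hF p i, smul_comm, smul_neg, smul_neg]
  have : IsAddTorsionFree E := .of_isTorsionFree ℝ E
  exact self_eq_neg.mp h

/-- The time derivative is the derivative along the line `t ↦ (x, t)`. -/
theorem hasDerivAt_td {f : ST n → E} {x : Fin n → ℝ} {t : ℝ}
    (hf : DifferentiableAt ℝ f (x, t)) : HasDerivAt (fun s => f (x, s)) (td f (x, t)) t :=
  hf.hasFDerivAt.comp_hasDerivAt t ((hasDerivAt_const t x).prodMk (hasDerivAt_id t))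

/-- the exponential (radial) gauge condition at `t = -1` propagates
to all `t < 0` along the soliton equation. -/
theorem radial_gauge_propagation (n m : ℕ) (A : Conn n m)
    (hsmooth : SmoothConnOn A {z : ST n | z.2 < 0})
    (heq : ∀ z : ST n, z.2 < 0 → ∀ i : Fin n,
      td (A i) z + (1 / (2 * z.2)) •
        (∑ p, z.1 p • (pd p (A i) z - pd i (A p) z
          + mmul (A p z) (A i z) - mmul (A i z) (A p z))) = 0)
    (hgauge : ∀ x : Fin n → ℝ, ∑ p, x p • A p (x, -1) = 0) :
    ∀ z : ST n, z.2 < 0 → ∑ p, z.1 p • A p z = 0 := by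
  rintro ⟨x, t⟩ ht
  have hopen : IsOpen {z : ST n | z.2 < 0} := isOpen_lt continuous_snd continuous_const
  have hderiv : ∀ s < 0, HasDerivAt (fun s => ∑ p, x p • A p (x, s)) 0 s := by
    intro s hs
    have hsum : ∑ i, x i • td (A i) (x, s) = 0 := by
      have hF := sum_smul_sum_smul_eq_zero_of_antisymm x
        (fun i p => pd p (A i) (x, s) - pd i (A p) (x, s)
          + mmul (A p (x, s)) (A i (x, s)) - mmul (A i (x, s)) (A p (x, s)))
        (fun i p => by abel)
      simp only [fun i => eq_neg_of_add_eq_zero_left (heq (x, s) hs i), smul_neg,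
        smul_comm _ (1 / (2 * s)), Finset.sum_neg_distrib, ← Finset.smul_sum, hF,
        smul_zero, neg_zero]
    rw [← hsum]
    refine HasDerivAt.fun_sum fun i _ => (hasDerivAt_td ?_).const_smul (x i)
    exact ((hsmooth i).contDiffAt (hopen.mem_nhds hs)).differentiableAt (by simp)
  have hconst := isOpen_Iio.is_const_of_deriv_eq_zero (convex_Iio (0 : ℝ)).isPreconnected
    (fun s hs => (hderiv s hs).differentiableAt.differentiableWithinAt)
    (fun s hs => (hderiv s hs).deriv) ht (show (-1 : ℝ) ∈ Set.Iio 0 by simp)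
  exact hconst.trans (hgauge x)

end

end YangMillsFlow
end

section
/- Let n be an integer with 5 ≤ n ≤ 9, and set a = √(n−2)/(2√2) and b = (1/2)(6n − 12 − (n+2)√(2n−4)). Define h(r,t) = ρ²/(aρ² + b) where ρ = r/√(−t). Then for every r > 0 and every t < 0, h satisfies ∂h/∂t = ∂²h/∂r² + (n−3)(∂h/∂r)/r − (n−2) h(h−1)(h−2)/r². -/
open MeasureTheory
open scoped BigOperators

namespace YangMillsFlow

noncomputable section

variable {n m : ℕ} {E : Type*} [NormedAddCommGroup E] [NormedSpace ℝ E]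

/-- The radial derivative of `r² / (a r² + c)`. -/
theorem hasDerivAt_sq_div_quadratic {a c r : ℝ} (hD : a * r ^ 2 + c ≠ 0) :
    HasDerivAt (fun u : ℝ => u ^ 2 / (a * u ^ 2 + c)) (2 * c * r / (a * r ^ 2 + c) ^ 2) r := by
  have hsq : HasDerivAt (fun u : ℝ => u ^ 2) (2 * r) r := by simpa using hasDerivAt_pow 2 r
  refine (hsq.div ((hsq.const_mul a).add_const c) hD).congr_deriv ?_
  field_simp
  ring

/-- The second radial derivative of `r² / (a r² + c)`, in terms of the first. -/
theorem hasDerivAt_deriv_sq_div_quadratic {a c r : ℝ} (hD : a * r ^ 2 + c ≠ 0) :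
    HasDerivAt (fun u : ℝ => 2 * c * u / (a * u ^ 2 + c) ^ 2)
      (2 * c * (c - 3 * a * r ^ 2) / (a * r ^ 2 + c) ^ 3) r := by
  have hsq : HasDerivAt (fun u : ℝ => u ^ 2) (2 * r) r := by simpa using hasDerivAt_pow 2 r
  have hden := ((hsq.const_mul a).add_const c).pow 2
  refine (((hasDerivAt_id r).const_mul (2 * c)).div hden (pow_ne_zero 2 hD)).congr_deriv ?_
  simp only [id, Pi.pow_apply]
  field_simp
  push_cast
  ring

/-- The time derivative of `r² / (a r² - b t)`. -/
theorem hasDerivAt_time_sq_div {a b r t : ℝ} (hD : a * r ^ 2 + b * -t ≠ 0) :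
    HasDerivAt (fun s : ℝ => r ^ 2 / (a * r ^ 2 + b * -s))
      (b * r ^ 2 / (a * r ^ 2 + b * -t) ^ 2) t := by
  have hden := ((hasDerivAt_neg t).const_mul b).const_add (a * r ^ 2)
  refine ((hasDerivAt_const t (r ^ 2)).div hden hD).congr_deriv ?_
  ring

/-- The self-similar profile in the variables `r` and `t`. -/
theorem div_sqrt_sq_div_eq (a b r : ℝ) {t : ℝ} (ht : t < 0) :
    (r / Real.sqrt (-t)) ^ 2 / (a * (r / Real.sqrt (-t)) ^ 2 + b) =
      r ^ 2 / (a * r ^ 2 + b * -t) := by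
  have hτ : -t ≠ 0 := (neg_pos.mpr ht).ne'
  rw [div_pow, Real.sq_sqrt (neg_pos.mpr ht).le]
  have hscale : a * (r ^ 2 / -t) + b = (a * r ^ 2 + b * -t) / -t := by
    rw [add_div, mul_div_assoc, mul_div_cancel_right₀ _ hτ]
  rw [hscale, div_div_div_cancel_right₀ hτ]

/-- the self-similar profile `h(r,t) = ρ²/(aρ² + b)`, `ρ = r/√(-t)`,
solves the equivariant reduction of the Yang-Mills flow. -/
theorem soliton_profile_solves (n : ℕ) (hn5 : 5 ≤ n) (hn9 : n ≤ 9) (a b : ℝ)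
    (ha : a = Real.sqrt ((n : ℝ) - 2) / (2 * Real.sqrt 2))
    (hb : b = (6 * (n : ℝ) - 12 - ((n : ℝ) + 2) * Real.sqrt (2 * (n : ℝ) - 4)) / 2)
    (h : ℝ → ℝ → ℝ)
    (hdef : ∀ r t : ℝ, h r t =
      (r / Real.sqrt (-t)) ^ 2 / (a * (r / Real.sqrt (-t)) ^ 2 + b)) :
    ∀ r t : ℝ, 0 < r → t < 0 →
      deriv (fun s => h r s) t =
        deriv (fun s => deriv (fun u => h u t) s) r
          + ((n : ℝ) - 3) * deriv (fun s => h s t) r / r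
          - ((n : ℝ) - 2) * h r t * (h r t - 1) * (h r t - 2) / r ^ 2 := by
  intro r t hr ht
  have hn5' : (5 : ℝ) ≤ n := by exact_mod_cast hn5
  have hn9' : (n : ℝ) ≤ 9 := by exact_mod_cast hn9
  have hsqrt : Real.sqrt (2 * (n : ℝ) - 4) = 4 * a := by
    have h2 : Real.sqrt 2 ^ 2 = 2 := Real.sq_sqrt zero_le_two
    have hpos : 0 < Real.sqrt 2 := Real.sqrt_pos.mpr two_pos
    rw [show 2 * (n : ℝ) - 4 = 2 * ((n : ℝ) - 2) by ring, Real.sqrt_mul zero_le_two, ha]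
    field_simp
    rw [h2]
    ring
  have ha0 : 0 < a := by
    have : 0 < Real.sqrt (2 * (n : ℝ) - 4) := Real.sqrt_pos.mpr (by linarith)
    linarith
  have hna : (n : ℝ) = 8 * a ^ 2 + 2 := by
    have hsq := Real.sq_sqrt (show 0 ≤ 2 * (n : ℝ) - 4 by linarith)
    rw [hsqrt] at hsq
    linarith
  have hba : b = 8 * a * (2 * a - 1) * (1 - a) := by
    rw [hb, hsqrt, hna]
    ring
  have hb0 : 0 < b := by
    have hlow : 0 < 2 * a - 1 := by nlinarith
    have hupp : 0 < 1 - a := by nlinarith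
    rw [hba]
    positivity
  have hD : ∀ u s : ℝ, s < 0 → a * u ^ 2 + b * -s ≠ 0 := by
    intro u s hs
    have : 0 < b * -s := mul_pos hb0 (neg_pos.mpr hs)
    positivity
  have hval : ∀ u s : ℝ, s < 0 → h u s = u ^ 2 / (a * u ^ 2 + b * -s) := fun u s hs =>
    (hdef u s).trans (div_sqrt_sq_div_eq a b u hs)
  have hspace : (fun u => h u t) = fun u => u ^ 2 / (a * u ^ 2 + b * -t) :=
    funext fun u => hval u t ht
  have htime : (fun s => h r s) =ᶠ[nhds t] fun s => r ^ 2 / (a * r ^ 2 + b * -s) := by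
    filter_upwards [Iio_mem_nhds ht] with s hs using hval r s hs
  have hspace' : deriv (fun u => h u t) =
      fun u => 2 * (b * -t) * u / (a * u ^ 2 + b * -t) ^ 2 := by
    rw [hspace]
    exact funext fun u => (hasDerivAt_sq_div_quadratic (hD u t ht)).deriv
  have hDr := hD r t ht
  rw [htime.deriv_eq, (hasDerivAt_time_sq_div hDr).deriv, hspace',
    (hasDerivAt_deriv_sq_div_quadratic hDr).deriv, hval r t ht, hna]
  have hr0 := hr.ne'
  beta_reduce
  generalize hDeq : a * r ^ 2 + b * -t = D at hDr ⊢
  field_simp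
  rw [← hDeq, hba]
  ring

end

end YangMillsFlow
end

section
/- Let n ≥ 3 be an integer, I ⊆ ℝ an open interval, and h : (0,∞) × I → ℝ a smooth function. Define the time-dependent connection A on the trivial bundle ℝⁿ × ℝⁿ by A_i(x,t) = −(h(|x|,t)/|x|²) σ_i(x) for x ≠ 0. Then A satisfies the Yang-Mills flow equation ∂_t A_j = Σ_p (∂_p F_{pj} + A_p F_{pj} − F_{pj} A_p) at every point of (ℝⁿ ∖ {0}) × I if and only if h satisfies ∂h/∂t = ∂²h/∂r² + (n−3)(∂h/∂r)/r − (n−2) h(h−1)(h−2)/r² at every point of (0,∞) × I. -/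
open MeasureTheory
open scoped BigOperators

namespace YangMillsFlow

noncomputable section

variable {n m : ℕ} {E : Type*} [NormedAddCommGroup E] [NormedSpace ℝ E]

/-- The skew-symmetric matrix `σᵢ(x)` with entries `(σᵢ(x))^α_β = δᵢ^α x^β - δᵢ^β x^α`. -/
def sigmaM (n : ℕ) (i : Fin n) (x : Fin n → ℝ) : Mat n :=
  fun α β => (if i = α then x β else 0) - (if i = β then x α else 0)

/-- The elementary skew-symmetric matrix `eᵢeⱼᵀ - eⱼeᵢᵀ`. -/
def skewUnit (n : ℕ) (i j : Fin n) : Mat n :=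
  fun α β => (if i = α then if j = β then 1 else 0 else 0)
    - (if i = β then if j = α then 1 else 0 else 0)

/-- The squared Euclidean norm of the spatial component. -/
def radSq (z : ST n) : ℝ := ∑ j, (z.1 j) ^ 2

/-- The Euclidean norm of the spatial component. -/
def rad (z : ST n) : ℝ := Real.sqrt (radSq z)

lemma radSq_pos {z : ST n} (hz : z.1 ≠ 0) : 0 < radSq z := by
  obtain ⟨i, hi⟩ := Function.ne_iff.mp hz
  exact Finset.sum_pos' (fun j _ => sq_nonneg _) ⟨i, Finset.mem_univ i, sq_pos_of_ne_zero hi⟩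

lemma rad_pos {z : ST n} (hz : z.1 ≠ 0) : 0 < rad z := Real.sqrt_pos.2 (radSq_pos hz)

lemma rad_sq (z : ST n) : rad z ^ 2 = radSq z :=
  Real.sq_sqrt (Finset.sum_nonneg fun _ _ => sq_nonneg _)

/-! ### Matrix algebra -/

lemma mmul_smul_left (c : ℝ) (a b : Mat m) : mmul (c • a) b = c • mmul a b := by
  ext α β; simp [mmul, Finset.mul_sum, mul_assoc]

lemma mmul_smul_right (c : ℝ) (a b : Mat m) : mmul a (c • b) = c • mmul a b := by
  ext α β; simp [mmul, Finset.mul_sum, mul_left_comm]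

lemma sigmaM_commutator (i j : Fin n) (z : ST n) :
    mmul (sigmaM n i z.1) (sigmaM n j z.1) - mmul (sigmaM n j z.1) (sigmaM n i z.1) =
      z.1 j • sigmaM n i z.1 - z.1 i • sigmaM n j z.1 - radSq z • skewUnit n i j := by
  ext α β
  simp only [mmul, sigmaM, skewUnit, radSq, Pi.sub_apply, Pi.smul_apply, smul_eq_mul, sub_mul,
    mul_sub, Finset.sum_sub_distrib, ite_mul, mul_ite, zero_mul, mul_zero, Finset.sum_ite_eq,
    Finset.mem_univ, if_true, mul_one]
  by_cases h1 : i = α <;> by_cases h2 : j = β <;> by_cases h3 : j = α <;> by_cases h4 : i = β <;>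
    by_cases h5 : α = β <;> simp [h1, h2, h3, h4, h5, eq_comm, pow_two] <;> ring

lemma sum_smul_sigmaM (x : Fin n → ℝ) : ∑ p, x p • sigmaM n p x = 0 := by
  ext α β
  simp [sigmaM, Finset.sum_apply, mul_sub, mul_comm]

lemma sum_smul_skewUnit (x : Fin n → ℝ) (j : Fin n) :
    ∑ p, x p • skewUnit n p j = -sigmaM n j x := by
  ext α β
  simp [sigmaM, skewUnit, Finset.sum_apply, mul_sub]

lemma sum_sigmaM_skewUnit_commutator (x : Fin n → ℝ) (j : Fin n) :
    ∑ p, (mmul (sigmaM n p x) (skewUnit n p j) - mmul (skewUnit n p j) (sigmaM n p x)) =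
      ((n : ℝ) - 2) • sigmaM n j x := by
  ext α β
  simp only [mmul, sigmaM, skewUnit, Finset.sum_apply, Pi.sub_apply, Pi.smul_apply, smul_eq_mul,
    sub_mul, mul_sub, Finset.sum_sub_distrib, ite_mul, mul_ite, zero_mul, mul_zero,
    Finset.sum_ite_eq, Finset.sum_ite_eq', Finset.mem_univ, if_true, mul_one, one_mul]
  by_cases h2 : j = β <;> by_cases h3 : j = α <;> by_cases h5 : α = β <;>
    simp [h2, h3, h5, eq_comm] <;> ring

/-! ### Product rules -/

lemma pd_smul {c : ST n → ℝ} {M : ST n → E} {z : ST n} (p : Fin n)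
    (hc : DifferentiableAt ℝ c z) (hM : DifferentiableAt ℝ M z) :
    pd p (fun w => c w • M w) z = pd p c z • M z + c z • pd p M z := by
  simp [pd, fderiv_fun_smul hc hM, add_comm]

lemma pd_const (p : Fin n) (c : E) (z : ST n) : pd p (fun _ => c) z = 0 := by
  simp [pd]

lemma pd_add {f g : ST n → E} {z : ST n} (p : Fin n)
    (hf : DifferentiableAt ℝ f z) (hg : DifferentiableAt ℝ g z) :
    pd p (fun w => f w + g w) z = pd p f z + pd p g z := by
  simp [pd, fderiv_fun_add hf hg]

lemma pd_sub {f g : ST n → E} {z : ST n} (p : Fin n)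
    (hf : DifferentiableAt ℝ f z) (hg : DifferentiableAt ℝ g z) :
    pd p (fun w => f w - g w) z = pd p f z - pd p g z := by
  simp [pd, fderiv_fun_sub hf hg]

lemma pd_congr {f g : ST n → E} {z : ST n} (p : Fin n) (hfg : f =ᶠ[nhds z] g) :
    pd p f z = pd p g z := by
  simp [pd, hfg.fderiv_eq]

lemma hasFDerivAt_coord (i : Fin n) (z : ST n) :
    HasFDerivAt (fun w : ST n => w.1 i)
      ((ContinuousLinearMap.proj i).comp (ContinuousLinearMap.fst ℝ (Fin n → ℝ) ℝ)) z :=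
  ContinuousLinearMap.hasFDerivAt
    ((ContinuousLinearMap.proj (R := ℝ) (φ := fun _ : Fin n => ℝ) i).comp
      (ContinuousLinearMap.fst ℝ (Fin n → ℝ) ℝ))

lemma pd_coord (p i : Fin n) (z : ST n) :
    pd p (fun w : ST n => w.1 i) z = if p = i then 1 else 0 := by
  simp [pd, (hasFDerivAt_coord i z).fderiv, spaceVec, Pi.single_apply, eq_comm]

lemma isLinearMap_sigmaM (i : Fin n) :
    IsLinearMap ℝ (fun w : ST n => sigmaM n i w.1) where
  map_add x y := by
    ext α β; simp only [sigmaM, Prod.fst_add, Pi.add_apply]; split_ifs <;> ring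
  map_smul c x := by
    ext α β; simp only [sigmaM, Prod.smul_fst, Pi.smul_apply, smul_eq_mul]; split_ifs <;> ring

lemma hasFDerivAt_sigmaM (i : Fin n) (z : ST n) :
    HasFDerivAt (fun w : ST n => sigmaM n i w.1)
      (LinearMap.toContinuousLinearMap (IsLinearMap.mk' _ (isLinearMap_sigmaM i))) z :=
  (LinearMap.toContinuousLinearMap (IsLinearMap.mk' _ (isLinearMap_sigmaM i))).hasFDerivAt

lemma pd_sigmaM (p i : Fin n) (z : ST n) :
    pd p (fun w : ST n => sigmaM n i w.1) z = -skewUnit n p i := by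
  rw [pd, (hasFDerivAt_sigmaM i z).fderiv]
  ext α β
  simp only [LinearMap.coe_toContinuousLinearMap', IsLinearMap.mk'_apply, sigmaM, skewUnit,
    spaceVec, Pi.single_apply, Pi.neg_apply]
  by_cases h1 : i = α <;> by_cases h2 : i = β <;> by_cases h3 : α = β <;>
    simp [h1, h2, h3, eq_comm]

lemma td_smul_sigmaM {c : ST n → ℝ} {z : ST n} (i : Fin n) (hc : DifferentiableAt ℝ c z) :
    td (fun w => c w • sigmaM n i w.1) z = td c z • sigmaM n i z.1 := by
  have h0 : sigmaM n i (0 : Fin n → ℝ) = 0 := by ext α β; simp [sigmaM]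
  rw [td, fderiv_fun_smul hc (hasFDerivAt_sigmaM i z).differentiableAt,
    (hasFDerivAt_sigmaM i z).fderiv]
  simp [td, timeVec, h0]

/-! ### Radial functions -/

lemma hasFDerivAt_radSq (z : ST n) :
    HasFDerivAt (radSq (n := n)) (∑ j, (2 * z.1 j) •
      (ContinuousLinearMap.proj (R := ℝ) (φ := fun _ : Fin n => ℝ) j).comp
        (ContinuousLinearMap.fst ℝ (Fin n → ℝ) ℝ)) z := by
  refine HasFDerivAt.fun_sum fun j _ => ?_
  simpa using (hasFDerivAt_coord j z).pow 2

lemma differentiableAt_rad {z : ST n} (hz : z.1 ≠ 0) : DifferentiableAt ℝ (rad (n := n)) z :=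
  (hasFDerivAt_radSq z).differentiableAt.sqrt (radSq_pos hz).ne'

lemma fderiv_rad {z : ST n} (hz : z.1 ≠ 0) (v : ST n) :
    fderiv ℝ (rad (n := n)) z v = (∑ j, z.1 j * v.1 j) / rad z := by
  have h1 := (hasFDerivAt_radSq z).sqrt (radSq_pos hz).ne'
  have h2 : fderiv ℝ (rad (n := n)) z = _ := h1.fderiv
  rw [h2]
  have := (rad_pos hz).ne'
  change ((1 / (2 * rad z)) • _ : ST n →L[ℝ] ℝ) v = _
  simp only [smul_apply, sum_apply, smul_eq_mul,
    ContinuousLinearMap.comp_apply, ContinuousLinearMap.proj_apply, ContinuousLinearMap.coe_fst',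
    mul_assoc, ← Finset.mul_sum]
  field_simp

section Radial

variable {G : ℝ → ℝ → ℝ} {z : ST n}

lemma differentiableAt_radial (hz : z.1 ≠ 0)
    (hG : DifferentiableAt ℝ (Function.uncurry G) (rad z, z.2)) :
    DifferentiableAt ℝ (fun w : ST n => G (rad w) w.2) z :=
  DifferentiableAt.comp (f := fun w : ST n => (rad w, w.2)) z hG
    ((differentiableAt_rad hz).prodMk differentiableAt_snd)

lemma fderiv_radial (hz : z.1 ≠ 0)
    (hG : DifferentiableAt ℝ (Function.uncurry G) (rad z, z.2)) (v : ST n) :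
    fderiv ℝ (fun w : ST n => G (rad w) w.2) z v =
      fderiv ℝ (Function.uncurry G) (rad z, z.2) (fderiv ℝ (rad (n := n)) z v, v.2) := by
  have h1 := hG.hasFDerivAt.comp (f := fun w : ST n => (rad w, w.2)) z
    ((differentiableAt_rad hz).hasFDerivAt.prodMk hasFDerivAt_snd)
  have h2 : fderiv ℝ (fun w : ST n => G (rad w) w.2) z = _ := h1.fderiv
  rw [h2]
  simp

end Radial

lemma hasDerivAt_left {G : ℝ → ℝ → ℝ} {r t : ℝ}
    (hG : DifferentiableAt ℝ (Function.uncurry G) (r, t)) :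
    HasDerivAt (fun s => G s t) (fderiv ℝ (Function.uncurry G) (r, t) (1, 0)) r := by
  have h1 : HasDerivAt (fun s : ℝ => (s, t)) ((1 : ℝ), (0 : ℝ)) r :=
    (hasDerivAt_id r).prodMk (hasDerivAt_const r t)
  exact HasFDerivAt.comp_hasDerivAt (f := fun s : ℝ => (s, t)) r hG.hasFDerivAt h1

lemma hasDerivAt_right {G : ℝ → ℝ → ℝ} {r t : ℝ}
    (hG : DifferentiableAt ℝ (Function.uncurry G) (r, t)) :
    HasDerivAt (fun s => G r s) (fderiv ℝ (Function.uncurry G) (r, t) (0, 1)) t := by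
  have h1 : HasDerivAt (fun s : ℝ => (r, s)) ((0 : ℝ), (1 : ℝ)) t :=
    (hasDerivAt_const t r).prodMk (hasDerivAt_id t)
  exact HasFDerivAt.comp_hasDerivAt (f := fun s : ℝ => (r, s)) t hG.hasFDerivAt h1

lemma pd_radial {G : ℝ → ℝ → ℝ} {z : ST n} (hz : z.1 ≠ 0)
    (hG : DifferentiableAt ℝ (Function.uncurry G) (rad z, z.2)) (p : Fin n) :
    pd p (fun w : ST n => G (rad w) w.2) z =
      deriv (fun s => G s z.2) (rad z) / rad z * z.1 p := by
  rw [pd, fderiv_radial hz hG, fderiv_rad hz, (hasDerivAt_left hG).deriv]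
  have : ((∑ j, z.1 j * (spaceVec n p).1 j) / rad z, (spaceVec n p).2) =
      (z.1 p / rad z) • ((1 : ℝ), (0 : ℝ)) := by
    simp [spaceVec, Pi.single_apply]
  rw [this, map_smul, smul_eq_mul]
  ring

lemma td_radial {G : ℝ → ℝ → ℝ} {z : ST n} (hz : z.1 ≠ 0)
    (hG : DifferentiableAt ℝ (Function.uncurry G) (rad z, z.2)) :
    td (fun w : ST n => G (rad w) w.2) z = deriv (fun s => G (rad z) s) z.2 := by
  rw [td, fderiv_radial hz hG, fderiv_rad hz, (hasDerivAt_right hG).deriv]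
  simp [timeVec]

lemma contDiffOn_deriv_left {G : ℝ → ℝ → ℝ} {U : Set (ℝ × ℝ)} (hU : IsOpen U)
    (hG : ContDiffOn ℝ (⊤ : ℕ∞) (Function.uncurry G) U) :
    ContDiffOn ℝ (⊤ : ℕ∞) (Function.uncurry fun r t => deriv (fun s => G s t) r) U := by
  have h1 : ContDiffOn ℝ (⊤ : ℕ∞) (fun q => fderiv ℝ (Function.uncurry G) q ((1 : ℝ), (0 : ℝ))) U :=
    (hG.fderiv_of_isOpen hU (by simp)).clm_apply contDiffOn_const
  refine h1.congr fun q hq => ?_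
  exact (hasDerivAt_left
    ((hG.differentiableOn (by simp)).differentiableAt (hU.mem_nhds hq))).deriv

/-! ### Curvature of the equivariant ansatz -/

/-- The curvature of `Aᵢ = f σᵢ` for a scalar function `f` with radial gradient `φ x`. -/
lemma curv_smul_sigmaM {f : ST n → ℝ} {φ : ℝ} {z : ST n} (hf : DifferentiableAt ℝ f z)
    (hφ : ∀ p, pd p f z = φ * z.1 p) (i j : Fin n) :
    curv (fun i w => f w • sigmaM n i w.1) i j z =
      (φ - f z ^ 2) • (z.1 i • sigmaM n j z.1 - z.1 j • sigmaM n i z.1) -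
        (2 * f z + f z ^ 2 * radSq z) • skewUnit n i j := by
  have hskew : skewUnit n j i = -skewUnit n i j := by
    ext α β
    simp only [skewUnit, Pi.neg_apply]
    split_ifs <;> simp
  have hcomm := sigmaM_commutator i j z
  rw [sub_eq_iff_eq_add] at hcomm
  simp only [curv, mmul_smul_left, mmul_smul_right, hcomm]
  rw [pd_smul i hf (hasFDerivAt_sigmaM j z).differentiableAt,
    pd_smul j hf (hasFDerivAt_sigmaM i z).differentiableAt, hφ, hφ, pd_sigmaM, pd_sigmaM, hskew]
  module

/-- The covariant divergence of `a (xₚ σⱼ - xⱼ σₚ) + b (eₚeⱼᵀ - eⱼeₚᵀ)` for scalar functions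
`a`, `b` with radial gradients, with respect to the connection `c σₚ` at the point `z`. -/
lemma covariant_divergence {a b : ST n → ℝ} {a' b' c : ℝ} {z : ST n}
    (ha : DifferentiableAt ℝ a z) (hb : DifferentiableAt ℝ b z)
    (ha' : ∀ p, pd p a z = a' * z.1 p) (hb' : ∀ p, pd p b z = b' * z.1 p) (j : Fin n)
    {F : Fin n → ST n → Mat n}
    (hF : ∀ p, F p =ᶠ[nhds z] fun w =>
      a w • (w.1 p • sigmaM n j w.1 - w.1 j • sigmaM n p w.1) + b w • skewUnit n p j) :
    ∑ p, (pd p (F p) z + mmul (c • sigmaM n p z.1) (F p z) - mmul (F p z) (c • sigmaM n p z.1)) =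
      (a' * radSq z + n * a z - b' + ((n : ℝ) - 2) * c * b z) • sigmaM n j z.1 := by
  have hσ (i : Fin n) := (hasFDerivAt_sigmaM i z).differentiableAt
  have hx (i : Fin n) := (hasFDerivAt_coord i z).differentiableAt
  have hpd (p : Fin n) : pd p (F p) z =
      (a' * z.1 p ^ 2 + a z) • sigmaM n j z.1
        - (a' * z.1 j) • z.1 p • sigmaM n p z.1
        + (b' - a z) • z.1 p • skewUnit n p j
        - a z • (if p = j then 1 else (0 : ℝ)) • sigmaM n p z.1 := by
    have hpp : skewUnit n p p = 0 := by
      ext α β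
      by_cases h1 : p = α <;> by_cases h2 : p = β <;> simp [skewUnit, h1, h2]
    rw [pd_congr p (hF p), pd_add p (ha.fun_smul (((hx p).fun_smul (hσ j)).fun_sub
        ((hx j).fun_smul (hσ p)))) (hb.fun_smul (differentiableAt_const _)),
      pd_smul p ha (((hx p).fun_smul (hσ j)).fun_sub ((hx j).fun_smul (hσ p))),
      pd_smul p hb (differentiableAt_const _), pd_const,
      pd_sub p ((hx p).fun_smul (hσ j)) ((hx j).fun_smul (hσ p)),
      pd_smul p (hx p) (hσ j), pd_smul p (hx j) (hσ p), pd_coord, pd_coord, pd_sigmaM, pd_sigmaM,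
      ha', hb', hpp, if_pos rfl]
    module
  have hcomm (p : Fin n) :
      mmul (c • sigmaM n p z.1) (F p z) - mmul (F p z) (c • sigmaM n p z.1) =
        (c * a z) • (mmul (z.1 p • sigmaM n p z.1) (sigmaM n j z.1)
          - mmul (sigmaM n j z.1) (z.1 p • sigmaM n p z.1))
        + (c * b z) • (mmul (sigmaM n p z.1) (skewUnit n p j)
          - mmul (skewUnit n p j) (sigmaM n p z.1)) := by
    rw [(hF p).self_of_nhds]
    ext α β
    simp only [mmul, Pi.sub_apply, Pi.add_apply, Pi.smul_apply, smul_eq_mul,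
      ← Finset.sum_sub_distrib, Finset.mul_sum, ← Finset.sum_add_distrib]
    exact Finset.sum_congr rfl fun γ _ => by ring
  have hsum1 : ∑ p, (mmul (z.1 p • sigmaM n p z.1) (sigmaM n j z.1)
      - mmul (sigmaM n j z.1) (z.1 p • sigmaM n p z.1)) = 0 := by
    have hl : ∑ p, mmul (z.1 p • sigmaM n p z.1) (sigmaM n j z.1) =
        mmul (∑ p, z.1 p • sigmaM n p z.1) (sigmaM n j z.1) := by
      ext α β
      simp only [mmul, Finset.sum_apply, Finset.sum_mul]
      exact Finset.sum_comm
    have hr : ∑ p, mmul (sigmaM n j z.1) (z.1 p • sigmaM n p z.1) =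
        mmul (sigmaM n j z.1) (∑ p, z.1 p • sigmaM n p z.1) := by
      ext α β
      simp only [mmul, Finset.sum_apply, Finset.mul_sum]
      exact Finset.sum_comm
    rw [Finset.sum_sub_distrib, hl, hr, sum_smul_sigmaM]
    ext α β
    simp [mmul]
  have hdelta : ∑ p, (if p = j then 1 else (0 : ℝ)) • sigmaM n p z.1 = sigmaM n j z.1 := by
    simp
  simp only [add_sub_assoc, hcomm]
  simp only [hpd, Finset.sum_add_distrib, Finset.sum_sub_distrib, ← Finset.smul_sum,
    ← Finset.sum_smul, ← Finset.mul_sum]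
  rw [← Finset.sum_sub_distrib, hsum1, ← Finset.sum_sub_distrib, sum_sigmaM_skewUnit_commutator,
    sum_smul_sigmaM, sum_smul_skewUnit, hdelta, ← radSq]
  simp only [Finset.sum_const, Finset.card_univ, Fintype.card_fin, nsmul_eq_mul]
  module

/-! ### The radial equation -/

/-- Derivatives of the two radial coefficient functions of the curvature, for a profile `k` with
first derivative `k₁` and second derivative `k₂`. -/
lemma hasDerivAt_curv_coeff {k k₁ : ℝ → ℝ} {k₂ r : ℝ} (hr : r ≠ 0)
    (hk : HasDerivAt k (k₁ r) r) (hk₁ : HasDerivAt k₁ k₂ r) :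
    HasDerivAt (fun s => (2 * k s - k s ^ 2) / s ^ 4 - k₁ s / s ^ 3)
      ((2 * k₁ r - 2 * k r * k₁ r) / r ^ 4 - 4 * (2 * k r - k r ^ 2) / r ^ 5
        - k₂ / r ^ 3 + 3 * k₁ r / r ^ 4) r ∧
    HasDerivAt (fun s => (2 * k s - k s ^ 2) / s ^ 2)
      ((2 * k₁ r - 2 * k r * k₁ r) / r ^ 2 - 2 * (2 * k r - k r ^ 2) / r ^ 3) r := by
  have hq : HasDerivAt (fun s => 2 * k s - k s ^ 2) (2 * k₁ r - 2 * k r * k₁ r) r := by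
    refine ((hk.const_mul 2).fun_sub (hk.fun_pow 2)).congr_deriv ?_
    push_cast; ring
  constructor
  · refine ((hq.fun_div (hasDerivAt_pow 4 r) (pow_ne_zero 4 hr)).fun_sub
      (hk₁.fun_div (hasDerivAt_pow 3 r) (pow_ne_zero 3 hr))).congr_deriv ?_
    field_simp
    push_cast
    ring
  · refine (hq.fun_div (hasDerivAt_pow 2 r) (pow_ne_zero 2 hr)).congr_deriv ?_
    field_simp
    push_cast
    ring

/-- the `SO(n)`-equivariant ansatz `Aᵢ(x,t) = -(h(|x|,t)/|x|²) σᵢ(x)` solves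
the Yang-Mills flow off the origin iff `h` solves the reduced scalar PDE. -/
theorem equivariant_reduction (n : ℕ) (hn : 3 ≤ n) (I : Set ℝ) (hI : IsOpen I)
    (hIconn : I.OrdConnected) (h : ℝ → ℝ → ℝ)
    (hsmooth : ContDiffOn ℝ (⊤ : ℕ∞) (Function.uncurry h) (Set.Ioi (0 : ℝ) ×ˢ I))
    (A : Conn n n)
    (hA : ∀ (i : Fin n) (z : ST n), A i z =
      (-(h (Real.sqrt (∑ j, (z.1 j) ^ 2)) z.2 / (∑ j, (z.1 j) ^ 2))) • sigmaM n i z.1) :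
    IsYMFlow A {z : ST n | z.1 ≠ 0 ∧ z.2 ∈ I} ↔
      ∀ r ∈ Set.Ioi (0 : ℝ), ∀ t ∈ I,
        deriv (fun s => h r s) t =
          deriv (fun s => deriv (fun u => h u t) s) r
            + ((n : ℝ) - 3) * deriv (fun s => h s t) r / r
            - ((n : ℝ) - 2) * h r t * (h r t - 1) * (h r t - 2) / r ^ 2 := by
  have hΩ : IsOpen (Set.Ioi (0 : ℝ) ×ˢ I) := isOpen_Ioi.prod hI
  have hdiff {r t : ℝ} (hr : 0 < r) (ht : t ∈ I) :
      DifferentiableAt ℝ (Function.uncurry h) (r, t) :=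
    (hsmooth.differentiableOn (by simp)).differentiableAt (hΩ.mem_nhds ⟨hr, ht⟩)
  set h₁ : ℝ → ℝ → ℝ := fun r t => deriv (fun s => h s t) r
  have hdiff₁ {r t : ℝ} (hr : 0 < r) (ht : t ∈ I) :
      DifferentiableAt ℝ (Function.uncurry h₁) (r, t) :=
    ((contDiffOn_deriv_left hΩ hsmooth).differentiableOn (by simp)).differentiableAt
      (hΩ.mem_nhds ⟨hr, ht⟩)
  have hk {r t : ℝ} (hr : 0 < r) (ht : t ∈ I) : HasDerivAt (fun s => h s t) (h₁ r t) r :=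
    (hasDerivAt_left (hdiff hr ht)).differentiableAt.hasDerivAt
  have hk₁ {r t : ℝ} (hr : 0 < r) (ht : t ∈ I) :
      HasDerivAt (fun s => h₁ s t) (deriv (fun s => h₁ s t) r) r :=
    (hasDerivAt_left (hdiff₁ hr ht)).differentiableAt.hasDerivAt
  set f : ℝ → ℝ → ℝ := fun s t => -(h s t / s ^ 2) with hf
  set a : ℝ → ℝ → ℝ := fun s t => (2 * h s t - h s t ^ 2) / s ^ 4 - h₁ s t / s ^ 3 with ha
  set b : ℝ → ℝ → ℝ := fun s t => (2 * h s t - h s t ^ 2) / s ^ 2 with hb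
  have hdiv_pow {g : ℝ × ℝ → ℝ} {r t : ℝ} (hr : 0 < r) (hg : DifferentiableAt ℝ g (r, t))
      (k : ℕ) : DifferentiableAt ℝ (fun q : ℝ × ℝ => g q / q.1 ^ k) (r, t) := by
    have hpow : DifferentiableAt ℝ (fun q : ℝ × ℝ => q.1 ^ k) (r, t) :=
      differentiableAt_fst.fun_pow k
    simp only [div_eq_mul_inv]
    exact hg.fun_mul (hpow.fun_inv (pow_ne_zero k hr.ne'))
  have hdf {r t : ℝ} (hr : 0 < r) (ht : t ∈ I) :
      DifferentiableAt ℝ (Function.uncurry f) (r, t) :=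
    (hdiv_pow hr (hdiff hr ht) 2).fun_neg
  have hdq {r t : ℝ} (hr : 0 < r) (ht : t ∈ I) :
      DifferentiableAt ℝ (fun q => 2 * Function.uncurry h q - Function.uncurry h q ^ 2) (r, t) :=
    ((hdiff hr ht).const_mul 2).fun_sub ((hdiff hr ht).fun_pow 2)
  have hda {r t : ℝ} (hr : 0 < r) (ht : t ∈ I) :
      DifferentiableAt ℝ (Function.uncurry a) (r, t) :=
    (hdiv_pow hr (hdq hr ht) 4).fun_sub (hdiv_pow hr (hdiff₁ hr ht) 3)
  have hdb {r t : ℝ} (hr : 0 < r) (ht : t ∈ I) :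
      DifferentiableAt ℝ (Function.uncurry b) (r, t) :=
    hdiv_pow hr (hdq hr ht) 2
  have hA' : A = fun i w => f (rad w) w.2 • sigmaM n i w.1 := by
    funext i w
    rw [hA, hf]
    simp only [rad_sq]
    rfl
  have hcurv (w : ST n) (hw : w.1 ≠ 0) (hwI : w.2 ∈ I) (i j : Fin n) :
      curv A i j w = a (rad w) w.2 • (w.1 i • sigmaM n j w.1 - w.1 j • sigmaM n i w.1)
        + b (rad w) w.2 • skewUnit n i j := by
    have hr := rad_pos hw
    have hfr : deriv (fun s => f s w.2) (rad w) =
        2 * h (rad w) w.2 / rad w ^ 3 - h₁ (rad w) w.2 / rad w ^ 2 := by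
      refine ((hk hr hwI).fun_div (hasDerivAt_pow 2 _) (pow_ne_zero 2 hr.ne')).fun_neg.deriv.trans ?_
      field_simp
      push_cast
      ring
    rw [hA', curv_smul_sigmaM (differentiableAt_radial hw (hdf hr hwI))
      (fun p => pd_radial hw (hdf hr hwI) p), hfr, ← rad_sq, sub_eq_add_neg _ (_ • skewUnit n i j),
      ← neg_smul]
    congr 2
    · simp only [hf, ha]
      field_simp
      ring
    · simp only [hf, hb]
      field_simp
      ring
  have hopen : IsOpen {z : ST n | z.1 ≠ 0 ∧ z.2 ∈ I} :=
    (isOpen_ne.preimage continuous_fst).inter (hI.preimage continuous_snd)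
  have hkey (z : ST n) (hz : z.1 ≠ 0) (hzI : z.2 ∈ I) (j : Fin n) :
      td (A j) z = (-(deriv (fun s => h (rad z) s) z.2 / rad z ^ 2)) • sigmaM n j z.1 ∧
      ∑ p, (pd p (fun w => curv A p j w) z + mmul (A p z) (curv A p j z)
        - mmul (curv A p j z) (A p z)) =
      (-((deriv (fun s => h₁ s z.2) (rad z)
            + ((n : ℝ) - 3) * h₁ (rad z) z.2 / rad z
            - ((n : ℝ) - 2) * h (rad z) z.2 * (h (rad z) z.2 - 1) * (h (rad z) z.2 - 2)
              / rad z ^ 2) / rad z ^ 2)) • sigmaM n j z.1 := by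
    have hr := rad_pos hz
    constructor
    · rw [hA', td_smul_sigmaM j (differentiableAt_radial hz (hdf hr hzI)),
        td_radial hz (hdf hr hzI)]
      congr 1
      simp only [hf, deriv.fun_neg, deriv_div_const]
    · have hcoeff := hasDerivAt_curv_coeff (k := fun s => h s z.2)
        (k₁ := fun s => h₁ s z.2) hr.ne' (hk hr hzI) (hk₁ hr hzI)
      have hdiv := covariant_divergence (c := f (rad z) z.2)
        (differentiableAt_radial hz (hda hr hzI)) (differentiableAt_radial hz (hdb hr hzI))
        (fun p => pd_radial hz (hda hr hzI) p) (fun p => pd_radial hz (hdb hr hzI) p) j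
        (F := fun p w => curv A p j w) fun p => by
          filter_upwards [hopen.mem_nhds ⟨hz, hzI⟩] with w hw
          exact hcurv w hw.1 hw.2 p j
      have hAz (p : Fin n) : A p z = f (rad z) z.2 • sigmaM n p z.1 := by rw [hA']
      simp only [hAz]
      rw [hdiv, hcoeff.1.deriv, hcoeff.2.deriv, ← rad_sq]
      congr 1
      simp only [hf, ha, hb]
      field_simp
      ring
  constructor
  · intro hflow r hr t ht
    let z : ST n := (Pi.single ⟨0, by omega⟩ r, t)
    have hr' : (0 : ℝ) < r := hr
    have hz : z.1 ≠ 0 := by simp [z, hr'.ne']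
    have hrad : rad z = r := by
      simp [rad, radSq, z, Pi.single_apply, Real.sqrt_sq hr'.le]
    have h1 := hflow z ⟨hz, ht⟩ ⟨1, by omega⟩
    obtain ⟨h2, h3⟩ := hkey z hz ht ⟨1, by omega⟩
    rw [h2, h3, hrad] at h1
    have h4 := congrFun (congrFun h1 ⟨1, by omega⟩) ⟨0, by omega⟩
    simp only [Pi.smul_apply, smul_eq_mul] at h4
    have h5 : sigmaM n ⟨1, by omega⟩ z.1 ⟨1, by omega⟩ ⟨0, by omega⟩ = r := by
      simp [sigmaM, z]
    rw [h5] at h4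
    have h6 := neg_injective (mul_right_cancel₀ hr'.ne' h4)
    exact (div_left_inj' (pow_ne_zero 2 hr'.ne')).1 h6
  · rintro hpde z ⟨hz, hzI⟩ j
    obtain ⟨h2, h3⟩ := hkey z hz hzI j
    rw [h2, h3, hpde (rad z) (rad_pos hz) z.2 hzI]

end

end YangMillsFlow
end
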